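/- Let a, b, c, μ ∈ ℂ with Re a > Re μ > 0 and Re(c-b) > Re μ > 0, and assume neither c nor c−μ is a nonpositive integer. Then for every real x < 1, one has ∫_{x}^{1} (1-y)^{a-μ-1} F(a,b;c;y) · (y-x)^{μ-1}/Γ(μ) dy = (Γ(a-μ)/Γ(a)) · (Γ(c-b-μ)/Γ(c-b)) · (Γ(c)/Γ(c-μ)) · (1-x)^{a-1} · F(a-μ,b;c-μ;x) (fractional integral transformation of type a−, c−). -/

import Mathlib

open MeasureTheory Set Complex Filter

/-- Pochhammer symbol `(a)_k = a (a+1) ⋯ (a+k-1)`. -/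
noncomputable def poch (a : ℂ) (k : ℕ) : ℂ := ∏ i ∈ Finset.range k, (a + i)

/-- The Gauss hypergeometric function `F(a,b;c;x)` for real `x < 1`, defined by the
power series on `[0,1)` and by the (agreeing) Pfaff series for `x < 0`. -/
noncomputable def hypF (a b c : ℂ) (x : ℝ) : ℂ :=
  if 0 ≤ x then
    ∑' k : ℕ, poch a k * poch b k / (poch c k * (Nat.factorial k : ℂ)) * (x : ℂ) ^ k
  else
    ((1 - x : ℝ) : ℂ) ^ (-a) *
      ∑' k : ℕ, poch a k * poch (c - b) k / (poch c k * (Nat.factorial k : ℂ)) *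
        (((x / (x - 1) : ℝ)) : ℂ) ^ k


/-! ### Pochhammer symbols and power series -/

noncomputable def hCoef (a b c : ℂ) (k : ℕ) : ℂ :=
  poch a k * poch b k / (poch c k * (Nat.factorial k : ℂ))

noncomputable def hSer (a b c z : ℂ) : ℂ := ∑' k : ℕ, hCoef a b c k * z ^ k

lemma poch_zero (a : ℂ) : poch a 0 = 1 := by simp [poch]

lemma poch_succ (a : ℂ) (k : ℕ) : poch a (k + 1) = poch a k * (a + k) := by
  simp [poch, Finset.prod_range_succ]

lemma poch_succ' (a : ℂ) (k : ℕ) : poch a (k + 1) = a * poch (a + 1) k := by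
  simp only [poch, Finset.prod_range_succ']
  rw [mul_comm]
  congr 1
  · simp
  · apply Finset.prod_congr rfl
    intro i _
    push_cast; ring

lemma poch_ne_zero {c : ℂ} (hc : ∀ n : ℕ, c ≠ -(n : ℂ)) (k : ℕ) : poch c k ≠ 0 := by
  rw [poch, Finset.prod_ne_zero_iff]
  intro i _ h
  exact hc i (eq_neg_of_add_eq_zero_left h)

lemma nonpos_shift {c : ℂ} (hc : ∀ n : ℕ, c ≠ -(n : ℂ)) : ∀ n : ℕ, c + 1 ≠ -(n : ℂ) := by
  intro n h
  apply hc (n + 1)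
  push_cast
  linear_combination h

lemma nonpos_of_re_pos {c : ℂ} (hc : 0 < c.re) : ∀ n : ℕ, c ≠ -(n : ℂ) := by
  intro n h
  have : c.re = -(n : ℝ) := by rw [h]; simp
  have h2 : (0 : ℝ) ≤ n := Nat.cast_nonneg n
  linarith

lemma hCoef_succ (a b c : ℂ) (k : ℕ) :
    hCoef a b c (k + 1) = hCoef a b c k * ((a + k) / (k + 1) * ((b + k) / (c + k))) := by
  simp only [hCoef, poch_succ, Nat.factorial_succ]
  push_cast
  simp only [div_eq_mul_inv, mul_inv]
  ring

lemma tendsto_ratio (a c : ℂ) :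
    Tendsto (fun k : ℕ => (a + k) / (c + k)) atTop (nhds 1) := by
  have h : Tendsto (fun k : ℕ => ((k : ℂ) + a) / ((k : ℂ) + c)) atTop (nhds 1) := by
    have h0 : ∀ d : ℂ, Tendsto (fun k : ℕ => 1 + d * (k : ℂ)⁻¹) atTop (nhds 1) := by
      intro d
      have := (tendsto_inv_atTop_nhds_zero_nat (𝕜 := ℂ)).const_mul d
      simpa using this.const_add 1
    have := (h0 a).div (h0 c) one_ne_zero
    rw [div_one] at this
    refine this.congr' ?_
    filter_upwards [eventually_gt_atTop 0] with k hk
    have hk' : (k : ℂ) ≠ 0 := by exact_mod_cast hk.ne'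
    simp only [Pi.div_apply]
    rw [← mul_div_mul_left _ _ hk']
    congr 1 <;> field_simp
  simpa [add_comm] using h

lemma hSer_summable (a b c : ℂ) {z : ℂ} (hz : ‖z‖ < 1) :
    Summable (fun k => hCoef a b c k * z ^ k) := by
  obtain ⟨r, hr1, hr2⟩ := exists_between hz
  refine summable_of_ratio_norm_eventually_le hr2 ?_
  have h : Tendsto (fun k : ℕ => ‖(a + k) / (1 + k) * ((b + k) / (c + k)) * z‖) atTop
      (nhds ‖z‖) := by
    have := (((tendsto_ratio a 1).mul (tendsto_ratio b c)).mul_const z).norm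
    simpa using this
  filter_upwards [h.eventually (gt_mem_nhds hr1)] with k hk
  rw [hCoef_succ, pow_succ]
  have : hCoef a b c k * ((a + k) / (k + 1) * ((b + k) / (c + k))) * (z ^ k * z)
    = ((a + k) / (1 + k) * ((b + k) / (c + k)) * z) * (hCoef a b c k * z ^ k) := by
    rw [add_comm (1 : ℂ)]; ring
  rw [this, norm_mul]
  gcongr

/-- generic series comparison -/
lemma hSer_combine {a b c a1 b1 c1 a2 b2 c2 K z : ℂ} (hz : ‖z‖ < 1)
    (h : ∀ k, hCoef a b c (k + 1) = hCoef a1 b1 c1 (k + 1) + K * hCoef a2 b2 c2 k) :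
    hSer a b c z = hSer a1 b1 c1 z + z * K * hSer a2 b2 c2 z := by
  have s1 := hSer_summable a b c hz
  have s2 := hSer_summable a1 b1 c1 hz
  have s3 := hSer_summable a2 b2 c2 hz
  unfold hSer
  rw [s1.tsum_eq_zero_add, s2.tsum_eq_zero_add, ← tsum_mul_left, add_assoc,
    ← Summable.tsum_add ((summable_nat_add_iff 1).2 s2) (s3.mul_left _)]
  congr 1
  congr 1
  ext k
  rw [h, pow_succ]; ring

lemma hSer_contig1 {a b c z : ℂ} (hz : ‖z‖ < 1) (hc : ∀ n : ℕ, c ≠ -(n : ℂ)) :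
    hSer a b c z = hSer a (b + 1) (c + 1) z
      + z * (-(a * (c - b) / (c * (c + 1)))) * hSer (a + 1) (b + 1) (c + 2) z := by
  apply hSer_combine hz
  intro k
  have hc' := nonpos_shift hc
  have hc'' := nonpos_shift hc'
  have e : c + 2 = c + 1 + 1 := by ring
  have n1 : c ≠ 0 := by simpa using hc 0
  have n2 : c + 1 ≠ 0 := by simpa using hc' 0
  have n3 := poch_ne_zero hc'' k
  have n4 : c + 1 + k ≠ 0 := fun h => hc' k (eq_neg_of_add_eq_zero_left h)
  have n5 : ((k.factorial : ℕ) : ℂ) ≠ 0 := by exact_mod_cast k.factorial_ne_zero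
  have n6 : (k : ℂ) + 1 ≠ 0 := by exact_mod_cast k.succ_ne_zero
  have r : poch (c + 1) k * (c + 1 + k) = (c + 1) * poch (c + 1 + 1) k := by
    rw [← poch_succ, poch_succ']
  have r' : poch (c + 1) k = (c + 1) * poch (c + 1 + 1) k / (c + 1 + k) := by
    rw [← r]; field_simp
  rw [e]
  simp only [hCoef, Nat.factorial_succ]
  rw [poch_succ' a, poch_succ' b, poch_succ' c, poch_succ' (c + 1), r', poch_succ (b + 1)]
  push_cast
  field_simp
  ring

lemma hSer_contig2 {a b c z : ℂ} (hz : ‖z‖ < 1) (hc : ∀ n : ℕ, c ≠ -(n : ℂ)) :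
    hSer a b c z = hSer a b (c + 1) z
      + z * (a * b / (c * (c + 1))) * hSer (a + 1) (b + 1) (c + 2) z := by
  apply hSer_combine hz
  intro k
  have hc' := nonpos_shift hc
  have hc'' := nonpos_shift hc'
  have e : c + 2 = c + 1 + 1 := by ring
  have n1 : c ≠ 0 := by simpa using hc 0
  have n2 : c + 1 ≠ 0 := by simpa using hc' 0
  have n3 := poch_ne_zero hc'' k
  have n4 : c + 1 + k ≠ 0 := fun h => hc' k (eq_neg_of_add_eq_zero_left h)
  have n5 : ((k.factorial : ℕ) : ℂ) ≠ 0 := by exact_mod_cast k.factorial_ne_zero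
  have n6 : (k : ℂ) + 1 ≠ 0 := by exact_mod_cast k.succ_ne_zero
  have r : poch (c + 1) k * (c + 1 + k) = (c + 1) * poch (c + 1 + 1) k := by
    rw [← poch_succ, poch_succ']
  have r' : poch (c + 1) k = (c + 1) * poch (c + 1 + 1) k / (c + 1 + k) := by
    rw [← r]; field_simp
  rw [e]
  simp only [hCoef, Nat.factorial_succ]
  rw [poch_succ' a, poch_succ' b, poch_succ' c, poch_succ' (c + 1), r']
  push_cast
  field_simp
  ring

lemma hypF_nonneg (a b c : ℂ) {x : ℝ} (hx : 0 ≤ x) : hypF a b c x = hSer a b c x := by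
  simp [hypF, hx, hSer, hCoef]

lemma hypF_neg (a b c : ℂ) {x : ℝ} (hx : x < 0) : hypF a b c x =
    ((1 - x : ℝ) : ℂ) ^ (-a) * hSer a (c - b) c ((x / (x - 1) : ℝ) : ℂ) := by
  simp [hypF, not_le.2 hx, hSer, hCoef]

lemma norm_pfaff {x : ℝ} (hx : x < 0) : ‖((x / (x - 1) : ℝ) : ℂ)‖ < 1 := by
  have h : 0 ≤ x / (x - 1) := div_nonneg_of_nonpos hx.le (by linarith)
  rw [Complex.norm_real, Real.norm_eq_abs, abs_of_nonneg h, div_lt_one_of_neg (by linarith)]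
  linarith

lemma hypF_contig {a b c : ℂ} (hc : ∀ n : ℕ, c ≠ -(n : ℂ)) {x : ℝ} (hx : x < 1) :
    hypF a b c x = hypF a (b + 1) (c + 1) x
      - x * (a * (c - b) / (c * (c + 1))) * hypF (a + 1) (b + 1) (c + 2) x := by
  rcases le_or_gt 0 x with h | h
  · rw [hypF_nonneg _ _ _ h, hypF_nonneg _ _ _ h, hypF_nonneg _ _ _ h, hSer_contig1 _ hc]
    · ring
    · rw [Complex.norm_real, Real.norm_eq_abs, abs_of_nonneg h]; exact hx
  · rw [hypF_neg _ _ _ h, hypF_neg _ _ _ h, hypF_neg _ _ _ h, hSer_contig2 (norm_pfaff h) hc]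
    have e1 : c + 1 - (b + 1) = c - b := by ring
    have e2 : c + 2 - (b + 1) = c - b + 1 := by ring
    have n : ((1 - x : ℝ) : ℂ) ≠ 0 := by exact_mod_cast (by linarith : 1 - x ≠ 0)
    have n' : (x : ℂ) - 1 ≠ 0 := by
      exact_mod_cast (by linarith : x - 1 ≠ 0)
    rw [e1, e2, neg_add, cpow_add _ _ n, cpow_neg_one]
    have e3 : ((x / (x - 1) : ℝ) : ℂ) = - (x * ((1 - x : ℝ) : ℂ)⁻¹) := by
      push_cast at n ⊢
      field_simp
      ring
    generalize hSer a (c - b) (c + 1) _ = A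
    generalize hSer (a + 1) (c - b + 1) (c + 2) _ = B
    rw [e3]
    ring

lemma poch_eq_choose (a : ℂ) (k : ℕ) :
    Ring.choose (a + k - 1) k = poch a k / (k.factorial : ℂ) := by
  rw [← Ring.multichoose_eq]
  have h := Ring.factorial_nsmul_multichoose_eq_ascPochhammer a k
  have n5 : ((k.factorial : ℕ) : ℂ) ≠ 0 := by exact_mod_cast k.factorial_ne_zero
  rw [eq_div_iff n5, mul_comm, ← nsmul_eq_mul, h, Polynomial.ascPochhammer_smeval_eq_eval]
  induction k with
  | zero => simp [poch_zero]
  | succ k ih =>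
    rw [ascPochhammer_succ_eval, poch_succ, ih]
    · exact Ring.factorial_nsmul_multichoose_eq_ascPochhammer a k
    · exact_mod_cast k.factorial_ne_zero

lemma binom_hasSum (a : ℂ) {z : ℂ} (hz : ‖z‖ < 1) :
    HasSum (fun k : ℕ => poch a k / (k.factorial : ℂ) * z ^ k) ((1 - z) ^ (-a)) := by
  have h := (one_div_one_sub_cpow_hasFPowerSeriesOnBall_zero a).hasSum (y := z) (by
    simpa [enorm_eq_nnnorm, ← NNReal.coe_lt_coe] using hz)
  simp only [zero_add, FormalMultilinearSeries.ofScalars_apply_eq, poch_eq_choose,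
    smul_eq_mul, one_div, ← cpow_neg] at h
  exact h

/-! ### Euler's integral -/

noncomputable def eul (b d e : ℂ) (x s : ℝ) : ℂ :=
  (s : ℂ) ^ (b - 1) * ((1 - s : ℝ) : ℂ) ^ (d - 1) * ((1 - x * s : ℝ) : ℂ) ^ (-e)

lemma beta_Ioo (u v : ℂ) : betaIntegral u v =
    ∫ s in Ioo (0 : ℝ) 1, (s : ℂ) ^ (u - 1) * ((1 - s : ℝ) : ℂ) ^ (v - 1) := by
  rw [betaIntegral, intervalIntegral.integral_of_le zero_le_one, integral_Ioc_eq_integral_Ioo]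
  push_cast
  rfl

lemma beta_integrable {u v : ℂ} (hu : 0 < u.re) (hv : 0 < v.re) :
    IntegrableOn (fun s : ℝ => (s : ℂ) ^ (u - 1) * ((1 - s : ℝ) : ℂ) ^ (v - 1)) (Ioo 0 1) := by
  have := betaIntegral_convergent hu hv
  rw [intervalIntegrable_iff_integrableOn_Ioo_of_le zero_le_one] at this
  push_cast
  exact this

lemma one_sub_mul_pos {x s : ℝ} (hx : x < 1) (h0 : 0 ≤ s) (h1 : s ≤ 1) : 0 < 1 - x * s := by
  rcases le_or_gt x 0 with h | h
  · nlinarith [mul_nonneg (neg_nonneg.2 h) h0]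
  · nlinarith

lemma eul_integrable {b d : ℂ} (e : ℂ) (hb : 0 < b.re) (hd : 0 < d.re) {x : ℝ} (hx : x < 1) :
    IntegrableOn (eul b d e x) (Ioo 0 1) := by
  have h := betaIntegral_convergent hb hd
  have h2 : ContinuousOn (fun s : ℝ => ((1 - x * s : ℝ) : ℂ) ^ (-e)) (uIcc (0:ℝ) 1) := by
    rw [uIcc_of_le zero_le_one]
    apply ContinuousOn.cpow_const
    · exact (Complex.continuous_ofReal.comp (by fun_prop)).continuousOn
    · intro s hs
      exact ofReal_mem_slitPlane.2 (one_sub_mul_pos hx hs.1 hs.2)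
  have h3 := h.mul_continuousOn h2
  rw [intervalIntegrable_iff_integrableOn_Ioo_of_le zero_le_one] at h3
  refine h3.congr_fun (fun s _ => ?_) measurableSet_Ioo
  simp [eul]

lemma Gamma_add_nat {b : ℂ} (hb : 0 < b.re) (k : ℕ) : Gamma (b + k) = Gamma b * poch b k := by
  induction k with
  | zero => simp [poch_zero]
  | succ k ih =>
    rw [poch_succ, ← mul_assoc, ← ih]
    push_cast
    rw [← add_assoc, Gamma_add_one, mul_comm]
    intro h
    have := congrArg Complex.re h
    simp at this
    have h2 : (0 : ℝ) ≤ k := Nat.cast_nonneg k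
    linarith

lemma euler_series {b d : ℂ} (a : ℂ) (hb : 0 < b.re) (hd : 0 < d.re) {x : ℝ} (h0 : 0 ≤ x)
    (hx : x < 1) :
    ∫ s in Ioo (0 : ℝ) 1, eul b d a x s =
      Gamma b * Gamma d / Gamma (b + d) * hSer a b (b + d) x := by
  have hbd : 0 < (b + d).re := by simp; linarith
  let β : ℝ → ℂ := fun s => (s : ℂ) ^ (b - 1) * ((1 - s : ℝ) : ℂ) ^ (d - 1)
  let F : ℕ → ℝ → ℂ := fun k s => β s * (poch a k / (k.factorial : ℂ) * ((x * s : ℝ) : ℂ) ^ k)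
  have hxn : ‖(x : ℂ)‖ < 1 := by rwa [Complex.norm_real, Real.norm_eq_abs, abs_of_nonneg h0]
  have hβ : IntegrableOn β (Ioo 0 1) := beta_integrable hb hd
  have hF : ∀ k s, 0 < s → F k s = poch a k / (k.factorial : ℂ) * (x : ℂ) ^ k *
      ((s : ℂ) ^ (b + k - 1) * ((1 - s : ℝ) : ℂ) ^ (d - 1)) := by
    intro k s hs
    have hs' : (s : ℂ) ≠ 0 := by exact_mod_cast hs.ne'
    have e : b + k - 1 = (b - 1) + k := by ring
    simp only [F, β]
    rw [e, cpow_add _ _ hs', cpow_natCast]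
    push_cast
    ring
  have hbk : ∀ k : ℕ, 0 < (b + k).re := by
    intro k; simp; positivity
  have hFi : ∀ k, IntegrableOn (F k) (Ioo 0 1) := by
    intro k
    refine IntegrableOn.congr_fun ((beta_integrable (hbk k) hd).const_mul
      (poch a k / (k.factorial : ℂ) * (x : ℂ) ^ k)) (fun s hs => ?_) measurableSet_Ioo
    exact (hF k s hs.1).symm
  have hsum : Summable fun k => ∫ s in Ioo (0 : ℝ) 1, ‖F k s‖ := by
    have hs := ((binom_hasSum a hxn).summable.norm).mul_right (∫ s in Ioo (0 : ℝ) 1, ‖β s‖)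
    refine hs.of_nonneg_of_le (fun k => integral_nonneg fun s => norm_nonneg _) (fun k => ?_)
    rw [← integral_const_mul]
    refine setIntegral_mono_on (hFi k).norm (hβ.norm.const_mul _) measurableSet_Ioo ?_
    intro s hs
    simp only [F]
    rw [norm_mul, mul_comm]
    gcongr
    rw [norm_mul, norm_mul, norm_pow, norm_pow]
    gcongr
    rw [Complex.norm_real, Complex.norm_real, norm_mul]
    rw [Real.norm_eq_abs s, abs_of_pos hs.1]
    nlinarith [norm_nonneg x, hs.2]
  have key := hasSum_integral_of_summable_integral_norm hFi hsum
  have e1 : ∫ s in Ioo (0 : ℝ) 1, ∑' k, F k s = ∫ s in Ioo (0 : ℝ) 1, eul b d a x s := by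
    refine setIntegral_congr_fun measurableSet_Ioo (fun s hs => ?_)
    have hz : ‖((x * s : ℝ) : ℂ)‖ < 1 := by
      rw [Complex.norm_real, Real.norm_eq_abs, abs_of_nonneg (mul_nonneg h0 hs.1.le)]
      nlinarith [hs.1, hs.2]
    have := ((binom_hasSum a hz).mul_left (β s)).tsum_eq
    simp only [F]
    rw [this]
    simp [eul, β]
  rw [← e1, ← key.tsum_eq, hSer, ← tsum_mul_left]
  congr 1
  ext k
  rw [setIntegral_congr_fun measurableSet_Ioo (fun s hs => hF k s hs.1), integral_const_mul,
    ← beta_Ioo]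
  have hG := Gamma_mul_Gamma_eq_betaIntegral (hbk k) hd
  have e2 : b + k + d = b + d + k := by ring
  rw [e2, Gamma_add_nat hb, Gamma_add_nat hbd] at hG
  have n1 := Gamma_ne_zero_of_re_pos hbd
  have n2 := poch_ne_zero (nonpos_of_re_pos hbd) k
  have : betaIntegral (b + k) d = Gamma b * poch b k * Gamma d / (Gamma (b + d) * poch (b + d) k) := by
    rw [hG]; field_simp
  rw [this, hCoef]
  field_simp

lemma eul_flip {b d a : ℂ} {x : ℝ} (hx : x < 0) :
    ∫ s in Ioo (0 : ℝ) 1, eul b d a x s =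
     ((1 - x : ℝ) : ℂ) ^ (-a) * ∫ s in Ioo (0 : ℝ) 1, eul d b a (x / (x - 1)) s := by
  have h := intervalIntegral.integral_comp_sub_left (a := 0) (b := 1)
    (fun s => eul b d a x s) 1
  simp only [sub_self, sub_zero] at h
  rw [← integral_Ioc_eq_integral_Ioo, ← integral_Ioc_eq_integral_Ioo,
    ← intervalIntegral.integral_of_le zero_le_one, ← intervalIntegral.integral_of_le zero_le_one,
    ← h, ← intervalIntegral.integral_const_mul]
  rw [intervalIntegral.integral_of_le zero_le_one, intervalIntegral.integral_of_le zero_le_one]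
  refine setIntegral_congr_fun measurableSet_Ioc (fun s hs => ?_)
  simp only [eul]
  have hx1 : x - 1 ≠ 0 := by linarith
  have e : 1 - x * (1 - s) = (1 - x) * (1 - x / (x - 1) * s) := by
    field_simp
    ring
  have hp : 0 ≤ 1 - x / (x - 1) * s := by
    have h1 : 0 ≤ x / (x - 1) := div_nonneg_of_nonpos hx.le (by linarith)
    have h2 : x / (x - 1) < 1 := by rw [div_lt_one_of_neg (by linarith)]; linarith
    nlinarith [hs.1, hs.2]
  rw [e, Complex.ofReal_mul, mul_cpow_ofReal_nonneg (by linarith) hp, sub_sub_cancel]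
  ring

lemma euler_hypF {b d : ℂ} (a : ℂ) (hb : 0 < b.re) (hd : 0 < d.re) {x : ℝ} (hx : x < 1) :
    ∫ s in Ioo (0 : ℝ) 1, eul b d a x s =
      Gamma b * Gamma d / Gamma (b + d) * hypF a b (b + d) x := by
  rcases le_or_gt 0 x with h | h
  · rw [hypF_nonneg _ _ _ h, euler_series a hb hd h hx]
  · have h1 : 0 ≤ x / (x - 1) := div_nonneg_of_nonpos h.le (by linarith)
    have h2 : x / (x - 1) < 1 := by rw [div_lt_one_of_neg (by linarith)]; linarith
    rw [eul_flip h, euler_series a hd hb h1 h2, hypF_neg _ _ _ h, add_sub_cancel_left, add_comm d b]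
    ring

/-! ### The kernel integral -/

noncomputable def kern (a μ : ℂ) (x s y : ℝ) : ℂ :=
  ((1 - y : ℝ) : ℂ) ^ (a - μ - 1) * ((y - x : ℝ) : ℂ) ^ (μ - 1) * ((1 - y * s : ℝ) : ℂ) ^ (-a)

noncomputable def mob (x s y : ℝ) : ℝ := (y - x) * (1 - s) / ((1 - x) * (1 - y * s))

noncomputable def mob' (x s y : ℝ) : ℝ :=
  (1 - s) * (1 - x * s) / ((1 - x) * ((1 - y * s) * (1 - y * s)))

lemma cpow_pos_exp {p : ℝ} (hp : 0 < p) (e : ℂ) : (p : ℂ) ^ e = cexp ((Real.log p : ℂ) * e) := by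
  rw [cpow_def_of_ne_zero (by exact_mod_cast hp.ne'), ofReal_log hp.le]

lemma ofReal_pos_exp {p : ℝ} (hp : 0 < p) : (p : ℂ) = cexp (Real.log p : ℂ) := by
  rw [← ofReal_exp, Real.exp_log hp]

lemma cpow_pos_norm {p : ℝ} (hp : 0 < p) (e : ℂ) :
    ((‖(p : ℂ) ^ e‖ : ℝ) : ℂ) = (p : ℂ) ^ (e.re : ℂ) := by
  rw [norm_cpow_eq_rpow_re_of_pos hp, ofReal_cpow hp.le]

lemma one_sub_mob {x s y : ℝ} (hx : x < 1) (hy : 0 < 1 - y * s) :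
    1 - mob x s y = (1 - y) * (1 - x * s) / ((1 - x) * (1 - y * s)) := by
  have h1 : 1 - x ≠ 0 := by linarith
  have h2 := hy.ne'
  rw [mob]
  field_simp
  ring

lemma mob_image {x s : ℝ} (hx : x < 1) (hs : s ∈ Ioo (0 : ℝ) 1) :
    mob x s '' Ioo x 1 = Ioo 0 1 := by
  have hxs : 0 < 1 - x * s := one_sub_mul_pos hx hs.1.le hs.2.le
  have h1 : 0 < 1 - x := by linarith
  have h2 : 0 < 1 - s := by linarith [hs.2]
  ext t
  constructor
  · rintro ⟨y, hy, rfl⟩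
    have hys : 0 < 1 - y * s := one_sub_mul_pos hy.2 hs.1.le hs.2.le
    have h3 : 0 < y - x := by linarith [hy.1]
    have h4 : 0 < 1 - y := by linarith [hy.2]
    refine ⟨by rw [mob]; positivity, ?_⟩
    rw [← sub_pos, one_sub_mob hx hys]
    positivity
  · intro ht
    have h3 : 0 < t := ht.1
    have h4 : 0 < 1 - t := by linarith [ht.2]
    have h5 := hs.1
    have hD : 0 < (1 - s) + t * s * (1 - x) := by positivity
    set D := (1 - s) + t * s * (1 - x) with hDdef
    have e1 : (x * (1 - s) + t * (1 - x)) / D - x = t * (1 - x) * (1 - x * s) / D := by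
      field_simp
      rw [hDdef]; ring
    have e2 : 1 - (x * (1 - s) + t * (1 - x)) / D = (1 - s) * (1 - x) * (1 - t) / D := by
      field_simp
      rw [hDdef]; ring
    have e3 : 1 - (x * (1 - s) + t * (1 - x)) / D * s = (1 - s) * (1 - x * s) / D := by
      field_simp
      rw [hDdef]; ring
    refine ⟨(x * (1 - s) + t * (1 - x)) / D, ⟨?_, ?_⟩, ?_⟩
    · rw [← sub_pos, e1]; positivity
    · rw [← sub_pos, e2]; positivity
    · rw [mob, e1, e3]
      field_simp

lemma mob_inj {x s : ℝ} (hx : x < 1) (hs : s ∈ Ioo (0 : ℝ) 1) : InjOn (mob x s) (Ioo x 1) := by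
  intro y hy z hz h
  have hxs : 0 < 1 - x * s := one_sub_mul_pos hx hs.1.le hs.2.le
  have h1 : 0 < 1 - x := by linarith
  have h2 : 0 < 1 - s := by linarith [hs.2]
  have hys : 0 < 1 - y * s := one_sub_mul_pos hy.2 hs.1.le hs.2.le
  have hzs : 0 < 1 - z * s := one_sub_mul_pos hz.2 hs.1.le hs.2.le
  rw [mob, mob, div_eq_div_iff (by positivity) (by positivity)] at h
  have h3 : ((1 - s) * (1 - x)) * ((1 - x * s) * (y - z)) = 0 := by linear_combination h
  have h4 : (1 - s) * (1 - x) ≠ 0 := by positivity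
  have h5 := (mul_eq_zero.1 ((mul_eq_zero.1 h3).resolve_left h4)).resolve_left hxs.ne'
  linarith

lemma mob_deriv {x s y : ℝ} (hx : x < 1) (hy : 0 < 1 - y * s) :
    HasDerivAt (mob x s) (mob' x s y) y := by
  have h1 : 1 - x ≠ 0 := by linarith
  have h2 := hy.ne'
  have d1 : HasDerivAt (fun y : ℝ => (y - x) * (1 - s)) (1 * (1 - s)) y :=
    ((hasDerivAt_id y).sub_const x).mul_const _
  have d2 : HasDerivAt (fun y : ℝ => (1 - x) * (1 - y * s)) ((1 - x) * (-(1 * s))) y :=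
    (((hasDerivAt_id y).mul_const s).const_sub 1).const_mul _
  have := d1.div d2 (mul_ne_zero h1 h2)
  convert! this using 1
  rw [mob']
  field_simp
  ring

lemma kern_eq {a μ : ℂ} {x s y : ℝ} (hx : x < 1) (hs : s ∈ Ioo (0 : ℝ) 1) (hy : y ∈ Ioo x 1) :
    |mob' x s y| • (((mob x s y : ℝ) : ℂ) ^ (μ - 1) * ((1 - mob x s y : ℝ) : ℂ) ^ (a - μ - 1)) =
    (((1 - s : ℝ) : ℂ) ^ μ * ((1 - x * s : ℝ) : ℂ) ^ (a - μ) * ((1 - x : ℝ) : ℂ) ^ (1 - a)) *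
      kern a μ x s y := by
  have hxs : 0 < 1 - x * s := one_sub_mul_pos hx hs.1.le hs.2.le
  have h1 : 0 < 1 - x := by linarith
  have h2 : 0 < 1 - s := by linarith [hs.2]
  have hys : 0 < 1 - y * s := one_sub_mul_pos hy.2 hs.1.le hs.2.le
  have h3 : 0 < y - x := by linarith [hy.1]
  have h4 : 0 < 1 - y := by linarith [hy.2]
  have p' : 0 < mob' x s y := by rw [mob']; positivity
  rw [one_sub_mob hx hys, abs_of_pos p', real_smul, kern]
  unfold mob mob'
  rw [ofReal_pos_exp (by positivity), cpow_pos_exp (by positivity), cpow_pos_exp (by positivity),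
    cpow_pos_exp h2, cpow_pos_exp hxs, cpow_pos_exp h1, cpow_pos_exp h4, cpow_pos_exp h3,
    cpow_pos_exp hys]
  simp only [← Complex.exp_add]
  congr 1
  rw [Real.log_div (by positivity) (by positivity), Real.log_div (by positivity) (by positivity),
    Real.log_div (by positivity) (by positivity), Real.log_mul h2.ne' hxs.ne',
    Real.log_mul h1.ne' (by positivity), Real.log_mul hys.ne' hys.ne',
    Real.log_mul h3.ne' h2.ne', Real.log_mul h1.ne' hys.ne', Real.log_mul h4.ne' hxs.ne']
  push_cast
  ring

lemma kern_const_inv {a μ : ℂ} {x s : ℝ} (hx : x < 1) (hs : s ∈ Ioo (0 : ℝ) 1) :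
    (((1 - s : ℝ) : ℂ) ^ (-μ) * ((1 - x * s : ℝ) : ℂ) ^ (-(a - μ)) * ((1 - x : ℝ) : ℂ) ^ (a - 1)) *
    (((1 - s : ℝ) : ℂ) ^ μ * ((1 - x * s : ℝ) : ℂ) ^ (a - μ) * ((1 - x : ℝ) : ℂ) ^ (1 - a)) = 1 := by
  have hxs : 0 < 1 - x * s := one_sub_mul_pos hx hs.1.le hs.2.le
  have h1 : 0 < 1 - x := by linarith
  have h2 : 0 < 1 - s := by linarith [hs.2]
  rw [cpow_pos_exp h2, cpow_pos_exp hxs, cpow_pos_exp h1, cpow_pos_exp h2, cpow_pos_exp hxs,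
    cpow_pos_exp h1]
  simp only [← Complex.exp_add]
  rw [← Complex.exp_zero]
  congr 1
  ring

lemma kern_integral {a μ : ℂ} {x s : ℝ} (hμ : 0 < μ.re) (ha : μ.re < a.re)
    (hx : x < 1) (hs : s ∈ Ioo (0 : ℝ) 1) :
    IntegrableOn (kern a μ x s) (Ioo x 1) ∧
    ∫ y in Ioo x 1, kern a μ x s y = betaIntegral μ (a - μ) *
      (((1 - s : ℝ) : ℂ) ^ (-μ) * ((1 - x * s : ℝ) : ℂ) ^ (-(a - μ)) *
        ((1 - x : ℝ) : ℂ) ^ (a - 1)) := by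
  have hd : ∀ y ∈ Ioo x 1, HasDerivWithinAt (mob x s) (mob' x s y) (Ioo x 1) y := fun y hy =>
    (mob_deriv hx (one_sub_mul_pos hy.2 hs.1.le hs.2.le)).hasDerivWithinAt
  have haμ : 0 < (a - μ).re := by simp; linarith
  have hI := beta_integrable hμ haμ
  have hB := beta_Ioo μ (a - μ)
  rw [← mob_image hx hs, integrableOn_image_iff_integrableOn_abs_deriv_smul measurableSet_Ioo hd
    (mob_inj hx hs)] at hI
  rw [← mob_image hx hs, integral_image_eq_integral_abs_deriv_smul measurableSet_Ioo hd
    (mob_inj hx hs)] at hB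
  rw [setIntegral_congr_fun measurableSet_Ioo (fun y hy => kern_eq hx hs hy),
    integral_const_mul] at hB
  have hI' := IntegrableOn.congr_fun hI (fun y hy => kern_eq hx hs hy) measurableSet_Ioo
  have hc := kern_const_inv (a := a) (μ := μ) hx hs
  constructor
  · have := hI'.const_mul (((1 - s : ℝ) : ℂ) ^ (-μ) * ((1 - x * s : ℝ) : ℂ) ^ (-(a - μ)) *
      ((1 - x : ℝ) : ℂ) ^ (a - 1))
    refine IntegrableOn.congr_fun this (fun y _ => ?_) measurableSet_Ioo
    rw [← mul_assoc, hc, one_mul]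
  · rw [hB, mul_comm, ← mul_assoc, hc, one_mul]

/-! ### Fubini -/

noncomputable def bigG (a b d μ : ℂ) (x y s : ℝ) : ℂ :=
  ((1 - y : ℝ) : ℂ) ^ (a - μ - 1) * ((y - x : ℝ) : ℂ) ^ (μ - 1) * eul b d a y s

lemma bigG_eq (a b d μ : ℂ) (x y s : ℝ) : bigG a b d μ x y s =
    ((s : ℂ) ^ (b - 1) * ((1 - s : ℝ) : ℂ) ^ (d - 1)) * kern a μ x s y := by
  simp only [bigG, eul, kern]; ring

lemma bigG_inner {a b d μ : ℂ} {x s : ℝ} (hμ : 0 < μ.re) (ha : μ.re < a.re)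
    (hx : x < 1) (hs : s ∈ Ioo (0 : ℝ) 1) :
    IntegrableOn (fun y => bigG a b d μ x y s) (Ioo x 1) ∧
    ∫ y in Ioo x 1, bigG a b d μ x y s =
      betaIntegral μ (a - μ) * ((1 - x : ℝ) : ℂ) ^ (a - 1) * eul b (d - μ) (a - μ) x s := by
  simp only [bigG_eq]
  obtain ⟨h1, h2⟩ := kern_integral hμ ha hx hs
  refine ⟨h1.const_mul _, ?_⟩
  rw [integral_const_mul, h2, eul]
  have hs' : ((1 - s : ℝ) : ℂ) ≠ 0 := by exact_mod_cast (by linarith [hs.2] : 1 - s ≠ 0)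
  have e : d - μ - 1 = (d - 1) + (-μ) := by ring
  rw [e, cpow_add _ _ hs']
  ring

lemma bigG_norm {a b d μ : ℂ} {x y s : ℝ} (hs : s ∈ Ioo (0 : ℝ) 1) (hy : y ∈ Ioo x 1) :
    ((‖bigG a b d μ x y s‖ : ℝ) : ℂ) = bigG a.re b.re d.re μ.re x y s := by
  have h2 : 0 < 1 - s := by linarith [hs.2]
  have hys : 0 < 1 - y * s := one_sub_mul_pos hy.2 hs.1.le hs.2.le
  have h3 : 0 < y - x := by linarith [hy.1]
  have h4 : 0 < 1 - y := by linarith [hy.2]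
  simp only [bigG, eul, norm_mul, ofReal_mul]
  rw [cpow_pos_norm hs.1, cpow_pos_norm h2, cpow_pos_norm hys, cpow_pos_norm h3, cpow_pos_norm h4]
  simp

lemma bigG_integrable {a b d μ : ℂ} {x : ℝ} (hμ : 0 < μ.re) (ha : μ.re < a.re)
    (hb : 0 < b.re) (hd : μ.re < d.re) (hx : x < 1) :
    Integrable (Function.uncurry (bigG a b d μ x))
      ((volume.restrict (Ioo x 1)).prod (volume.restrict (Ioo (0 : ℝ) 1))) := by
  have hm : Measurable (Function.uncurry (bigG a b d μ x)) := by
    unfold bigG eul Function.uncurry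
    fun_prop
  rw [integrable_prod_iff' hm.aestronglyMeasurable]
  constructor
  · filter_upwards [ae_restrict_mem measurableSet_Ioo] with s hs
    exact (bigG_inner hμ ha hx hs).1
  · have key : ∀ s ∈ Ioo (0 : ℝ) 1,
        ((∫ y in Ioo x 1, ‖bigG a b d μ x y s‖ : ℝ) : ℂ) =
        betaIntegral μ.re (a.re - μ.re) * ((1 - x : ℝ) : ℂ) ^ ((a.re : ℂ) - 1) *
          eul b.re (d.re - μ.re) (a.re - μ.re) x s := by
      intro s hs
      rw [← (bigG_inner (a := a.re) (μ := μ.re) (b := b.re) (d := d.re) (by simpa) (by simpa)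
        hx hs).2, ← integral_complex_ofReal]
      exact setIntegral_congr_fun measurableSet_Ioo (fun y hy => bigG_norm hs hy)
    have hI : IntegrableOn (fun s => betaIntegral μ.re (a.re - μ.re) *
        ((1 - x : ℝ) : ℂ) ^ ((a.re : ℂ) - 1) *
          eul b.re (d.re - μ.re) (a.re - μ.re) x s) (Ioo 0 1) :=
      (eul_integrable _ (by simpa) (by simpa) hx).const_mul _
    have hI2 := (IntegrableOn.congr_fun hI (fun s hs => (key s hs).symm) measurableSet_Ioo).re
    simpa using hI2

noncomputable def lhsF (a b c μ : ℂ) (x y : ℝ) : ℂ :=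
  ((1 - y : ℝ) : ℂ) ^ (a - μ - 1) * hypF a b c y * ((y - x : ℝ) : ℂ) ^ (μ - 1)

def Claim (a b c μ : ℂ) (x : ℝ) : Prop :=
  IntegrableOn (lhsF a b c μ x) (Ioo x 1) ∧
  ∫ y in Ioo x 1, lhsF a b c μ x y = Gamma μ * (Gamma (a - μ) / Gamma a *
        (Gamma (c - b - μ) / Gamma (c - b)) * (Gamma c / Gamma (c - μ)) *
        ((1 - x : ℝ) : ℂ) ^ (a - 1) * hypF (a - μ) b (c - μ) x)

lemma claim_base {a b d μ : ℂ} {x : ℝ} (hμ : 0 < μ.re) (ha : μ.re < a.re)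
    (hb : 0 < b.re) (hd : μ.re < d.re) (hx : x < 1) : Claim a b (b + d) μ x := by
  have hG := bigG_integrable hμ ha hb hd hx
  have hd0 : 0 < d.re := hμ.trans hd
  have hdμ : 0 < (d - μ).re := by simpa using hd
  have haμ : 0 < (a - μ).re := by simpa using ha
  have hbd : 0 < (b + d).re := by simp; linarith
  have n1 := Gamma_ne_zero_of_re_pos hb
  have n2 := Gamma_ne_zero_of_re_pos hd0
  have n3 := Gamma_ne_zero_of_re_pos hbd
  have n4 := Gamma_ne_zero_of_re_pos (hμ.trans ha)
  have e : ∀ y ∈ Ioo x 1, ∫ s in Ioo (0 : ℝ) 1, bigG a b d μ x y s =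
      (Gamma b * Gamma d / Gamma (b + d)) * lhsF a b (b + d) μ x y := by
    intro y hy
    simp only [bigG, lhsF]
    rw [integral_const_mul, euler_hypF a hb hd0 hy.2]
    ring
  have hsw := integral_integral_swap hG
  rw [setIntegral_congr_fun measurableSet_Ioo e, integral_const_mul,
    setIntegral_congr_fun measurableSet_Ioo (fun s hs => (bigG_inner hμ ha hx hs).2),
    integral_const_mul, euler_hypF _ hb hdμ hx] at hsw
  have hB := Gamma_mul_Gamma_eq_betaIntegral hμ haμ
  rw [add_sub_cancel] at hB
  constructor
  · have h1 : IntegrableOn _ (Ioo x 1) := hG.integral_prod_left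
    have h2 := (IntegrableOn.congr_fun h1 e measurableSet_Ioo).const_mul
      (Gamma b * Gamma d / Gamma (b + d))⁻¹
    refine IntegrableOn.congr_fun h2 (fun y _ => ?_) measurableSet_Ioo
    field_simp
  · have hB' : betaIntegral μ (a - μ) = Gamma μ * Gamma (a - μ) / Gamma a := by
      rw [hB]; field_simp
    have e1 : b + d - b - μ = d - μ := by ring
    have e2 : b + d - b = d := by ring
    have e3 : b + (d - μ) = b + d - μ := by ring
    rw [hB', e3] at hsw
    rw [e1, e2]
    have : ∫ y in Ioo x 1, lhsF a b (b + d) μ x y = (Gamma b * Gamma d / Gamma (b + d))⁻¹ *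
      ((Gamma b * Gamma d / Gamma (b + d)) * ∫ y in Ioo x 1, lhsF a b (b + d) μ x y) := by
      field_simp
    rw [this, hsw]
    field_simp

lemma claim_step {a b c μ : ℂ} {x : ℝ} (hμ : 0 < μ.re) (ha : μ.re < a.re)
    (hcb : μ.re < (c - b).re) (hc1 : ∀ n : ℕ, c ≠ -(n : ℂ)) (hc2 : ∀ n : ℕ, c - μ ≠ -(n : ℂ))
    (hx : x < 1) (C1 : Claim a (b + 1) (c + 1) μ x) (C2 : Claim (a + 1) (b + 1) (c + 2) μ x)
    (C3 : Claim (a + 1) (b + 1) (c + 2) (μ + 1) x) : Claim a b c μ x := by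
  obtain ⟨i1, v1⟩ := C1
  obtain ⟨i2, v2⟩ := C2
  obtain ⟨i3, v3⟩ := C3
  have hx0 : (1 : ℂ) - x ≠ 0 := by exact_mod_cast (by linarith : 1 - x ≠ 0)
  have hx0' : ((1 - x : ℝ) : ℂ) ≠ 0 := by exact_mod_cast (by linarith : 1 - x ≠ 0)
  set K : ℂ := a * (c - b) / (c * (c + 1)) / (1 - x) with hK
  have e : ∀ y ∈ Ioo x 1, lhsF a b c μ x y = lhsF a (b + 1) (c + 1) μ x y -
      (K * x * lhsF (a + 1) (b + 1) (c + 2) μ x y +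
        K * lhsF (a + 1) (b + 1) (c + 2) (μ + 1) x y) := by
    intro y hy
    have hy1 : ((1 - y : ℝ) : ℂ) ≠ 0 := by exact_mod_cast (by linarith [hy.2] : 1 - y ≠ 0)
    have hy2 : ((y - x : ℝ) : ℂ) ≠ 0 := by exact_mod_cast (by linarith [hy.1] : y - x ≠ 0)
    simp only [lhsF]
    rw [hypF_contig hc1 hy.2]
    have q1 : a + 1 - μ - 1 = (a - μ - 1) + 1 := by ring
    have q2 : a + 1 - (μ + 1) - 1 = a - μ - 1 := by ring
    have q3 : μ + 1 - 1 = (μ - 1) + 1 := by ring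
    rw [q1, q2, q3, cpow_add _ _ hy1, cpow_add _ _ hy2, cpow_one, cpow_one, hK]
    generalize hypF a (b + 1) (c + 1) y = A
    generalize hypF (a + 1) (b + 1) (c + 2) y = B
    generalize ((1 - y : ℝ) : ℂ) ^ (a - μ - 1) = P
    generalize ((y - x : ℝ) : ℂ) ^ (μ - 1) = Q
    generalize a * (c - b) / (c * (c + 1)) = L
    push_cast
    field_simp
    ring
  have i23 : Integrable (fun y => K * x * lhsF (a + 1) (b + 1) (c + 2) μ x y +
      K * lhsF (a + 1) (b + 1) (c + 2) (μ + 1) x y) (volume.restrict (Ioo x 1)) := (i2.const_mul (K * x)).add (i3.const_mul K)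
  have i123 := i1.sub i23
  refine ⟨IntegrableOn.congr_fun i123 (fun y hy => (e y hy).symm) measurableSet_Ioo, ?_⟩
  rw [setIntegral_congr_fun measurableSet_Ioo e, integral_sub i1 i23,
    integral_add (i2.const_mul (K * x)) (i3.const_mul K), integral_const_mul, integral_const_mul,
    v1, v2, v3, hypF_contig (a := a - μ) (b := b) hc2 hx]
  have hc1' := nonpos_shift hc1
  have hc2' := nonpos_shift hc2
  have n1 : c ≠ 0 := by simpa using hc1 0
  have n2 : c + 1 ≠ 0 := by simpa using hc1' 0
  have n3 : c - μ ≠ 0 := by simpa using hc2 0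
  have n4 : c - μ + 1 ≠ 0 := by simpa using hc2' 0
  have ra : 0 < a.re := hμ.trans ha
  have raμ : 0 < (a - μ).re := by simpa using ha
  have rcb : 0 < (c - b).re := hμ.trans hcb
  have rcbμ : 0 < (c - b - μ).re := by
    rw [sub_re (c - b)]; linarith
  have ne : ∀ z : ℂ, 0 < z.re → z ≠ 0 := by
    rintro z hz rfl
    simp at hz
  have m1 := ne _ ra
  have m2 := ne _ raμ
  have m3 := ne _ rcb
  have m4 := ne _ rcbμ
  have m5 := ne _ hμ
  have g1 := Gamma_ne_zero_of_re_pos ra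
  have g2 := Gamma_ne_zero_of_re_pos rcb
  have g3 := Gamma_ne_zero hc1
  have g4 := Gamma_ne_zero hc2
  have s1 : c + 1 - (b + 1) - μ = c - b - μ := by ring
  have s2 : c + 1 - (b + 1) = c - b := by ring
  have s3 : c + 1 - μ = (c - μ) + 1 := by ring
  have s4 : a + 1 - μ = (a - μ) + 1 := by ring
  have s5 : c + 2 - (b + 1) - μ = (c - b - μ) + 1 := by ring
  have s6 : c + 2 - (b + 1) = (c - b) + 1 := by ring
  have s7 : c + 2 - μ = (c - μ) + 2 := by ring
  have s8 : a + 1 - (μ + 1) = a - μ := by ring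
  have s9 : c + 2 - (μ + 1) = c - μ + 1 := by ring
  have s10 : c - b + 1 - (μ + 1) = c - b - μ := by ring
  have s11 : a + 1 - 1 = (a - 1) + 1 := by ring
  have s12 : c - μ - b = c - b - μ := by ring
  have t1 : Gamma (c + 2) = (c + 1) * (c * Gamma c) := by
    rw [← Gamma_add_one _ n1, ← Gamma_add_one _ n2]; congr 1; ring
  have t2 : Gamma (c - μ + 2) = (c - μ + 1) * ((c - μ) * Gamma (c - μ)) := by
    rw [← Gamma_add_one _ n3, ← Gamma_add_one _ n4]; congr 1; ring
  rw [s1, s2, s3, s4, s5, s6, s7, s8, s9, s10, s11, s12, t1, t2, Gamma_add_one _ n1,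
    Gamma_add_one _ n3, Gamma_add_one _ m1, Gamma_add_one _ m2, Gamma_add_one _ m3,
    Gamma_add_one _ m4, Gamma_add_one _ m5, cpow_add _ _ hx0', cpow_one, hK]
  generalize hypF _ _ _ _ = A
  generalize hypF _ _ _ _ = B
  generalize ((1 - x : ℝ) : ℂ) ^ (a - 1) = P
  push_cast
  field_simp
  ring

lemma claim_all (n : ℕ) : ∀ (a b c μ : ℂ) (x : ℝ), μ.re < a.re → μ.re < (c - b).re → 0 < μ.re →
    (∀ n : ℕ, c ≠ -(n : ℂ)) → (∀ n : ℕ, c - μ ≠ -(n : ℂ)) → x < 1 → 0 < b.re + n →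
    Claim a b c μ x := by
  induction n with
  | zero =>
    intro a b c μ x ha hcb hμ hc1 hc2 hx hb
    have := claim_base hμ ha (by simpa using hb) hcb hx
    rwa [add_sub_cancel] at this
  | succ n ih =>
    intro a b c μ x ha hcb hμ hc1 hc2 hx hb
    have hb' : 0 < (b + 1).re + n := by
      push_cast at hb
      simp only [add_re, one_re]; linarith
    have e3 : c + 2 = c + 1 + 1 := by ring
    have e4 : c + 1 - μ = c - μ + 1 := by ring
    have e5 : c + 1 + 1 - μ = c - μ + 1 + 1 := by ring
    have e6 : c + 1 + 1 - (μ + 1) = c - μ + 1 := by ring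
    simp only [sub_re] at hcb
    refine claim_step hμ ha (by simpa using hcb) hc1 hc2 hx ?_ ?_ ?_
    · refine ih _ _ _ _ _ ha ?_ hμ (nonpos_shift hc1) ?_ hx hb'
      · simpa using hcb
      · rw [e4]; exact nonpos_shift hc2
    · rw [e3]
      refine ih _ _ _ _ _ ?_ ?_ hμ (nonpos_shift (nonpos_shift hc1)) ?_ hx hb'
      · simp; linarith
      · simp; linarith
      · rw [e5]; exact nonpos_shift (nonpos_shift hc2)
    · rw [e3]
      refine ih _ _ _ _ _ ?_ ?_ ?_ (nonpos_shift (nonpos_shift hc1)) ?_ hx hb'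
      · simp; linarith
      · simp; linarith
      · simp; linarith
      · rw [e6]; exact nonpos_shift hc2

/-- Fractional integral transformation of type `a-, c-`. -/
theorem stmt_6 (a b c μ : ℂ) (ha : μ.re < a.re) (hcb : μ.re < (c - b).re) (hμ : 0 < μ.re)
    (hc1 : ∀ n : ℕ, c ≠ -(n : ℂ)) (hc2 : ∀ n : ℕ, c - μ ≠ -(n : ℂ))
    (x : ℝ) (hx : x < 1) :
    ∫ y in Ioo x 1,
        ((1 - y : ℝ) : ℂ) ^ (a - μ - 1) * hypF a b c y *
          (((y - x : ℝ) : ℂ) ^ (μ - 1) / Complex.Gamma μ)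
      = Complex.Gamma (a - μ) / Complex.Gamma a *
        (Complex.Gamma (c - b - μ) / Complex.Gamma (c - b)) *
        (Complex.Gamma c / Complex.Gamma (c - μ)) *
        ((1 - x : ℝ) : ℂ) ^ (a - 1) * hypF (a - μ) b (c - μ) x := by
  obtain ⟨n, hn⟩ := exists_nat_gt (-b.re)
  have h := (claim_all n a b c μ x ha hcb hμ hc1 hc2 hx (by linarith)).2
  have n1 := Gamma_ne_zero_of_re_pos hμ
  have e : ∀ y : ℝ, ((1 - y : ℝ) : ℂ) ^ (a - μ - 1) * hypF a b c y *
          (((y - x : ℝ) : ℂ) ^ (μ - 1) / Complex.Gamma μ) =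
      (Gamma μ)⁻¹ * lhsF a b c μ x y := by
    intro y
    simp only [lhsF, div_eq_mul_inv]
    ring
  simp only [e]
  rw [integral_const_mul, h, ← mul_assoc, inv_mul_cancel₀ n1, one_mul]
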